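/- arXiv:2203.06344 — 2 statements merged into one kernel-verified Lean document; each statement's English description precedes it below -/
import Mathlib

section
/- Let X be a T0 topological space. Then X is a c-space if and only if X is a directed space such that for every x ∈ X the set ⇓_d x = {y ∈ X : y ≪_d x} is directed and converges to x; and this holds if and only if X is a directed space such that for every x ∈ X there exists a directed subset D ⊆ ⇓_d x with D → x. -/
open Set TopologicalSpace

universe u

variable {X : Type*}

/-- Specialization order: `x ⊑ y` iff `x ∈ cl {y}`. -/
def specLE (t : TopologicalSpace X) (x y : X) : Prop := x ∈ @closure X t {y}

/-- `↑A` with respect to the specialization order. -/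
def upSet (t : TopologicalSpace X) (A : Set X) : Set X := {z | ∃ a ∈ A, specLE t a z}

/-- `↓A` with respect to the specialization order. -/
def downSet (t : TopologicalSpace X) (A : Set X) : Set X := {z | ∃ a ∈ A, specLE t z a}

/-- A directed subset with respect to the specialization order. -/
def DirSet (t : TopologicalSpace X) (D : Set X) : Prop :=
  D.Nonempty ∧ ∀ a ∈ D, ∀ b ∈ D, ∃ c ∈ D, specLE t a c ∧ specLE t b c

/-- `D → x`: every open set containing `x` meets `D`. -/
def DConv (t : TopologicalSpace X) (D : Set X) (x : X) : Prop :=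
  ∀ U : Set X, t.IsOpen U → x ∈ U → (D ∩ U).Nonempty

/-- Directed-open subset. -/
def DirOpen (t : TopologicalSpace X) (U : Set X) : Prop :=
  ∀ D : Set X, DirSet t D → ∀ x ∈ U, DConv t D x → (D ∩ U).Nonempty

/-- A directed space: every directed-open set is open. -/
def DirSpace (t : TopologicalSpace X) : Prop :=
  ∀ U : Set X, DirOpen t U → t.IsOpen U

/-- `x ≪_d y`. -/
def dWay (t : TopologicalSpace X) (x y : X) : Prop :=
  ∀ D : Set X, DirSet t D → DConv t D y → ∃ d ∈ D, specLE t x d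

/-- c-space. -/
def CSpace (t : TopologicalSpace X) : Prop :=
  ∀ (x : X) (U : Set X), t.IsOpen U → x ∈ U → ∃ y ∈ U, x ∈ @interior X t (upSet t {y})

/-- b-space. -/
def BSpace (t : TopologicalSpace X) : Prop :=
  ∀ (x : X) (U : Set X), t.IsOpen U → x ∈ U →
    ∃ y ∈ U, t.IsOpen (upSet t {y}) ∧ x ∈ upSet t {y} ∧ upSet t {y} ⊆ U

/-- locally hypercompact space. -/
def LocallyHypercompact (t : TopologicalSpace X) : Prop :=
  ∀ (U : Set X), t.IsOpen U → ∀ x ∈ U, ∃ F : Set X, F.Finite ∧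
    x ∈ @interior X t (upSet t F) ∧ upSet t F ⊆ U

/-- `s` is the supremum of `A` with respect to the specialization order. -/
def IsSupOf (t : TopologicalSpace X) (A : Set X) (s : X) : Prop :=
  (∀ a ∈ A, specLE t a s) ∧ ∀ y : X, (∀ a ∈ A, specLE t a y) → specLE t s y

/-- Topological ideal: a directed lower set possessing a supremum to which it converges. -/
def TopIdeal (t : TopologicalSpace X) (A : Set X) : Prop :=
  DirSet t A ∧ downSet t A = A ∧ ∃ s : X, IsSupOf t A s ∧ DConv t A s

/-- The set `I_T(X)` of topological ideals. -/
abbrev IT (t : TopologicalSpace X) := {A : Set X // TopIdeal t A}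

/-- The family `Ω(I_T(X))`. -/
def OmegaOpen (t : TopologicalSpace X) (U : Set (IT t)) : Prop :=
  ∀ A : IT t, A ∈ U ↔ ∃ B ∈ U, (∃ x : X, B.1 = downSet t {x}) ∧ B.1 ⊆ A.1

/-- Way-below relation in a complete lattice. -/
def wayBelow {L : Type*} [CompleteLattice L] (a b : L) : Prop :=
  ∀ D : Set L, D.Nonempty → DirectedOn (· ≤ ·) D → b ≤ sSup D → ∃ d ∈ D, a ≤ d

/-- Continuous (complete) lattice. -/
def ContinuousLattice (L : Type*) [CompleteLattice L] : Prop :=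
  ∀ x : L, {a : L | wayBelow a x}.Nonempty ∧ DirectedOn (· ≤ ·) {a : L | wayBelow a x} ∧
    sSup {a : L | wayBelow a x} = x

/-- Completely distributive complete lattice. -/
def CompletelyDistrib (L : Type u) [CompleteLattice L] : Prop :=
  ∀ (ι : Type u) (κ : ι → Type u) (f : (i : ι) → κ i → L),
    (⨅ i, ⨆ j, f i j) = ⨆ g : (i : ι) → κ i, ⨅ i, f i (g i)

/-- `↑F` in a preordered set. -/
def upOf {L : Type*} [Preorder L] (F : Set L) : Set L := {z | ∃ f ∈ F, f ≤ z}

/-- `F ≪ x` for a set `F` in a complete lattice. -/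
def finWay {L : Type*} [CompleteLattice L] (F : Set L) (x : L) : Prop :=
  ∀ D : Set L, D.Nonempty → DirectedOn (· ≤ ·) D → x ≤ sSup D → ∃ d ∈ D, ∃ f ∈ F, f ≤ d

/-- Quasicontinuous complete lattice. -/
def QuasicontinuousLattice (L : Type*) [CompleteLattice L] : Prop :=
  ∀ x : L,
    (∀ F G : Set L, F.Finite → finWay F x → G.Finite → finWay G x →
      ∃ H : Set L, H.Finite ∧ finWay H x ∧ upOf H ⊆ upOf F ∧ upOf H ⊆ upOf G) ∧
    Set.Ici x = ⋂₀ {S : Set L | ∃ F : Set L, F.Finite ∧ finWay F x ∧ S = upOf F}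

/-- Algebraic complete lattice: every element is the sup of the compact elements below it. -/
def AlgebraicLattice (L : Type*) [CompleteLattice L] : Prop :=
  ∀ x : L, sSup {k : L | wayBelow k k ∧ k ≤ x} = x

/-- Scott-open subset of a preordered set. -/
def ScottOpen {L : Type*} [Preorder L] (U : Set L) : Prop :=
  IsUpperSet U ∧ ∀ D : Set L, D.Nonempty → DirectedOn (· ≤ ·) D →
    ∀ s : L, IsLUB D s → s ∈ U → (D ∩ U).Nonempty

/-- The Scott topology. -/
def scottSp (L : Type*) [Preorder L] : TopologicalSpace L :=
  TopologicalSpace.generateFrom {U : Set L | ScottOpen U}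

/-- The upper topology. -/
def upperSp (L : Type*) [Preorder L] : TopologicalSpace L :=
  TopologicalSpace.generateFrom {S : Set L | ∃ a : L, S = (Set.Iic a)ᶜ}


theorem s3_open_up {X : Type*} (t : TopologicalSpace X) {a b : X} (h : specLE t a b)
    {U : Set X} (hU : t.IsOpen U) (ha : a ∈ U) : b ∈ U := by
  obtain ⟨z, hz, hz'⟩ := mem_closure_iff.1 h U hU ha
  rw [Set.mem_singleton_iff] at hz'
  exact hz' ▸ hz

theorem s3_refl {X : Type*} (t : TopologicalSpace X) (a : X) : specLE t a a :=
  subset_closure (Set.mem_singleton a)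

theorem s3_trans {X : Type*} (t : TopologicalSpace X) {a b c : X} (h : specLE t a b)
    (h' : specLE t b c) : specLE t a c :=
  mem_closure_iff.2 fun _ hU ha =>
    ⟨c, s3_open_up t h' hU (s3_open_up t h hU ha), Set.mem_singleton c⟩

theorem s3_dir_single {X : Type*} (t : TopologicalSpace X) (a : X) : DirSet t {a} := by
  refine ⟨⟨a, rfl⟩, ?_⟩
  rintro _ rfl _ rfl
  exact ⟨_, rfl, s3_refl t _, s3_refl t _⟩

theorem s3_conv_single {X : Type*} (t : TopologicalSpace X) {a b : X} (h : specLE t a b) :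
    DConv t {b} a :=
  fun _ hU ha => ⟨b, rfl, s3_open_up t h hU ha⟩

theorem s3_int_up {X : Type*} (t : TopologicalSpace X) {a x : X}
    (h : x ∈ interior (upSet t {a})) : specLE t a x := by
  obtain ⟨_, rfl, h2⟩ := interior_subset h
  exact h2

theorem s3_c_dir {X : Type*} (t : TopologicalSpace X) (hc : CSpace t) (x : X) :
    DirSet t {y | x ∈ interior (upSet t {y})} ∧ DConv t {y | x ∈ interior (upSet t {y})} x := by
  refine ⟨⟨?_, ?_⟩, ?_⟩
  · obtain ⟨y, _, h⟩ := hc x Set.univ t.isOpen_univ trivial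
    exact ⟨y, h⟩
  · intro a ha b hb
    obtain ⟨y, hy, h⟩ := hc x (interior (upSet t {a}) ∩ interior (upSet t {b}))
      (isOpen_interior.inter isOpen_interior) ⟨ha, hb⟩
    exact ⟨y, h, s3_int_up t hy.1, s3_int_up t hy.2⟩
  · intro U hU hx
    obtain ⟨y, hy, h⟩ := hc x U hU hx
    exact ⟨y, h, hy⟩

theorem s3_c_eq {X : Type*} (t : TopologicalSpace X) (hc : CSpace t) (x : X) :
    {y | dWay t y x} = {y | x ∈ interior (upSet t {y})} := by
  ext y
  constructor
  · intro h
    obtain ⟨d, hd, hyd⟩ := h _ (s3_c_dir t hc x).1 (s3_c_dir t hc x).2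
    refine interior_mono ?_ hd
    rintro z ⟨_, rfl, hz⟩
    exact ⟨y, rfl, s3_trans t hyd hz⟩
  · intro h D _ hD
    obtain ⟨d, hd, hd'⟩ := hD _ isOpen_interior h
    exact ⟨d, hd, s3_int_up t hd'⟩

theorem s3_c_space {X : Type*} (t : TopologicalSpace X) (hc : CSpace t) : DirSpace t := by
  intro U hU
  refine isOpen_iff_mem_nhds.2 fun x hx => ?_
  obtain ⟨d, hd, hdU⟩ := hU _ (s3_c_dir t hc x).1 x hx (s3_c_dir t hc x).2
  refine Filter.mem_of_superset (mem_interior_iff_mem_nhds.1 hd) ?_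
  rintro z ⟨_, rfl, hz⟩
  obtain ⟨_, rfl, h⟩ := hU _ (s3_dir_single t z) _ hdU (s3_conv_single t hz)
  exact h

theorem s3_to_c {X : Type*} (t : TopologicalSpace X) (hs : DirSpace t)
    (h : ∀ x : X, ∃ D : Set X, DirSet t D ∧ D ⊆ {y : X | dWay t y x} ∧ DConv t D x) :
    CSpace t := by
  intro x U hU hx
  obtain ⟨D, _, hDx, hDc⟩ := h x
  obtain ⟨y, hyD, hyU⟩ := hDc U hU hx
  refine ⟨y, hyU, ?_⟩
  have hmono : ∀ {a b c : X}, dWay t a b → specLE t b c → dWay t a c :=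
    fun hab hbc E hE hEc => hab E hE fun V hV hb => hEc V hV (s3_open_up t hbc hV hb)
  have hop : IsOpen {z | dWay t y z} := by
    refine hs _ fun D hD z hz hDz => ?_
    have hE : DirSet t {e | ∃ d ∈ D, dWay t e d} := by
      constructor
      · obtain ⟨d, hd⟩ := hD.1
        obtain ⟨E, hE, hEd, _⟩ := h d
        obtain ⟨e, he⟩ := hE.1
        exact ⟨e, d, hd, hEd he⟩
      · rintro a ⟨d1, hd1, ha⟩ b ⟨d2, hd2, hb⟩
        obtain ⟨d, hd, h1, h2⟩ := hD.2 d1 hd1 d2 hd2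
        obtain ⟨E, hE, hEd, hEc⟩ := h d
        obtain ⟨c1, hc1, hac⟩ := hmono ha h1 E hE hEc
        obtain ⟨c2, hc2, hbc⟩ := hmono hb h2 E hE hEc
        obtain ⟨c, hc, h1c, h2c⟩ := hE.2 c1 hc1 c2 hc2
        exact ⟨c, ⟨d, hd, hEd hc⟩, s3_trans t hac h1c, s3_trans t hbc h2c⟩
    have hEz : DConv t {e | ∃ d ∈ D, dWay t e d} z := by
      intro V hV hzV
      obtain ⟨d, hd, hdV⟩ := hDz V hV hzV
      obtain ⟨E, _, hEd, hEc⟩ := h d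
      obtain ⟨e, he, heV⟩ := hEc V hV hdV
      exact ⟨e, ⟨d, hd, hEd he⟩, heV⟩
    obtain ⟨e, ⟨d, hd, hed⟩, hye⟩ := hz _ hE hEz
    refine ⟨d, hd, fun F hF hFd => ?_⟩
    obtain ⟨f, hf, hef⟩ := hed F hF hFd
    exact ⟨f, hf, s3_trans t hye hef⟩
  refine mem_interior.2 ⟨_, ?_, hop, hDx hyD⟩
  intro z hz
  obtain ⟨_, rfl, hyz⟩ := hz _ (s3_dir_single t z) (s3_conv_single t (s3_refl t z))
  exact ⟨y, rfl, hyz⟩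

theorem statement3 {X : Type*} [t : TopologicalSpace X] [T0Space X] :
    (CSpace t ↔ (DirSpace t ∧ ∀ x : X,
        DirSet t {y : X | dWay t y x} ∧ DConv t {y : X | dWay t y x} x)) ∧
    (CSpace t ↔ (DirSpace t ∧ ∀ x : X,
        ∃ D : Set X, DirSet t D ∧ D ⊆ {y : X | dWay t y x} ∧ DConv t D x)) := by
  have h12 : CSpace t → (DirSpace t ∧ ∀ x : X,
      DirSet t {y : X | dWay t y x} ∧ DConv t {y : X | dWay t y x} x) := by
    intro hc
    refine ⟨s3_c_space t hc, fun x => ?_⟩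
    rw [s3_c_eq t hc x]
    exact s3_c_dir t hc x
  exact ⟨⟨h12, fun h => s3_to_c t h.1 fun x => ⟨_, (h.2 x).1, subset_rfl, (h.2 x).2⟩⟩,
    ⟨fun hc => ⟨(h12 hc).1, fun x => ⟨_, ((h12 hc).2 x).1, subset_rfl, ((h12 hc).2 x).2⟩⟩,
      fun h => s3_to_c t h.1 h.2⟩⟩
end

section
/- Let X be a T0 topological space. Then Ω(I_T(X)) is a topology on the set I_T(X) of topological ideals of X, and the space (I_T(X), Ω(I_T(X))) is a T0 space whose specialization order is set-theoretic inclusion; moreover it is a b-space, and its d-compact elements are exactly the principal ideals, i.e., {A ∈ I_T(X) : A ≪_d A} = {↓x : x ∈ X}. -/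
open Set TopologicalSpace

universe u

variable {X : Type*}

theorem spec_refl_aux {X : Type*} (t : TopologicalSpace X) (x : X) : specLE t x x :=
  @subset_closure X t {x} x rfl

theorem spec_iff_aux {X : Type*} (t : TopologicalSpace X) (x y : X) :
    specLE t x y ↔ ∀ U : Set X, t.IsOpen U → x ∈ U → y ∈ U := by
  letI := t
  unfold specLE
  rw [mem_closure_iff]
  constructor
  · intro h U hU hx
    obtain ⟨z, hz, hz'⟩ := h U hU hx
    rw [mem_singleton_iff] at hz'
    exact hz' ▸ hz
  · intro h U hU hx
    exact ⟨y, h U hU hx, rfl⟩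

theorem spec_trans_aux {X : Type*} (t : TopologicalSpace X) {x y z : X}
    (h : specLE t x y) (h' : specLE t y z) : specLE t x z := by
  rw [spec_iff_aux] at *
  exact fun U hU hx => h' U hU (h U hU hx)

theorem mem_down_aux {X : Type*} (t : TopologicalSpace X) (x y : X) :
    y ∈ downSet t {x} ↔ specLE t y x := by
  simp [downSet]

/-- The principal ideal of a point. -/
def prinIdeal {X : Type*} (t : TopologicalSpace X) (x : X) : IT t :=
  ⟨downSet t {x}, by
    have hx : x ∈ downSet t {x} := (mem_down_aux t x x).2 (spec_refl_aux t x)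
    refine ⟨⟨⟨x, hx⟩, fun a ha b hb => ⟨x, hx, (mem_down_aux t x a).1 ha,
      (mem_down_aux t x b).1 hb⟩⟩, ?_, x, ⟨fun a ha => (mem_down_aux t x a).1 ha,
      fun y hy => hy x hx⟩, fun U _ hU => ⟨x, hx, hU⟩⟩
    ext z
    constructor
    · rintro ⟨a, ha, hz⟩
      exact (mem_down_aux t x z).2 (spec_trans_aux t hz ((mem_down_aux t x a).1 ha))
    · intro hz
      exact ⟨z, hz, spec_refl_aux t z⟩⟩

theorem self_mem_prin {X : Type*} (t : TopologicalSpace X) (x : X) : x ∈ (prinIdeal t x).1 :=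
  (mem_down_aux t x x).2 (spec_refl_aux t x)

theorem lower_aux {X : Type*} (t : TopologicalSpace X) (A : IT t) {x y : X}
    (h : specLE t x y) (hy : y ∈ A.1) : x ∈ A.1 := by
  rw [← A.2.2.1]
  exact ⟨y, hy, h⟩

theorem prin_sub_iff {X : Type*} (t : TopologicalSpace X) (A : IT t) (x : X) :
    (prinIdeal t x).1 ⊆ A.1 ↔ x ∈ A.1 :=
  ⟨fun h => h (self_mem_prin t x),
    fun h z hz => lower_aux t A ((mem_down_aux t x z).1 hz) h⟩

theorem omega_iff_aux {X : Type*} (t : TopologicalSpace X) (U : Set (IT t)) :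
    OmegaOpen t U ↔ ∀ A : IT t, A ∈ U ↔ ∃ x ∈ A.1, prinIdeal t x ∈ U := by
  unfold OmegaOpen
  refine forall_congr' fun A => ?_
  have : (∃ B ∈ U, (∃ x : X, B.1 = downSet t {x}) ∧ B.1 ⊆ A.1) ↔
      ∃ x ∈ A.1, prinIdeal t x ∈ U := by
    constructor
    · rintro ⟨B, hB, ⟨x, hx⟩, hs⟩
      have e : B = prinIdeal t x := Subtype.ext hx
      subst e
      exact ⟨x, (prin_sub_iff t A x).1 hs, hB⟩
    · rintro ⟨x, hx, hU⟩
      exact ⟨_, hU, ⟨x, rfl⟩, (prin_sub_iff t A x).2 hx⟩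
  rw [this]

theorem omega_upper_aux {X : Type*} (t : TopologicalSpace X) {U : Set (IT t)}
    (hU : OmegaOpen t U) {A B : IT t} (h : A.1 ⊆ B.1) (hA : A ∈ U) : B ∈ U := by
  rw [omega_iff_aux] at hU
  obtain ⟨x, hx, hp⟩ := (hU A).1 hA
  exact (hU B).2 ⟨x, h hx, hp⟩

theorem omega_up_aux {X : Type*} (t : TopologicalSpace X) (x : X) :
    OmegaOpen t {A : IT t | x ∈ A.1} := by
  rw [omega_iff_aux]
  intro A
  constructor
  · intro h
    exact ⟨x, h, self_mem_prin t x⟩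
  · rintro ⟨y, hy, h⟩
    exact lower_aux t A ((mem_down_aux t y x).1 h) hy

/-- The topology of topological ideals. -/
def omegaTop {X : Type*} (t : TopologicalSpace X) : TopologicalSpace (IT t) where
  IsOpen := OmegaOpen t
  isOpen_univ := by
    rw [omega_iff_aux]
    intro A
    obtain ⟨x, hx⟩ := A.2.1.1
    exact ⟨fun _ => ⟨x, hx, trivial⟩, fun _ => trivial⟩
  isOpen_inter := by
    intro U V hU hV
    rw [omega_iff_aux]
    intro A
    constructor
    · rintro ⟨h1, h2⟩
      obtain ⟨x, hx, hxU⟩ := ((omega_iff_aux t U).1 hU A).1 h1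
      obtain ⟨y, hy, hyV⟩ := ((omega_iff_aux t V).1 hV A).1 h2
      obtain ⟨c, hc, hxc, hyc⟩ := A.2.1.2 x hx y hy
      refine ⟨c, hc, omega_upper_aux t hU ?_ hxU, omega_upper_aux t hV ?_ hyV⟩
      · exact (prin_sub_iff t _ x).2 ((mem_down_aux t c x).2 hxc)
      · exact (prin_sub_iff t _ y).2 ((mem_down_aux t c y).2 hyc)
    · rintro ⟨x, hx, h1, h2⟩
      have hs := (prin_sub_iff t A x).2 hx
      exact ⟨omega_upper_aux t hU hs h1, omega_upper_aux t hV hs h2⟩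
  isOpen_sUnion := by
    intro S hS
    rw [omega_iff_aux]
    intro A
    constructor
    · rintro ⟨U, hU, hA⟩
      obtain ⟨x, hx, h⟩ := ((omega_iff_aux t U).1 (hS U hU) A).1 hA
      exact ⟨x, hx, U, hU, h⟩
    · rintro ⟨x, hx, U, hU, h⟩
      exact ⟨U, hU, omega_upper_aux t (hS U hU) ((prin_sub_iff t A x).2 hx) h⟩

theorem omega_spec_aux {X : Type*} (t : TopologicalSpace X) (A B : IT t) :
    specLE (omegaTop t) A B ↔ A.1 ⊆ B.1 := by
  rw [spec_iff_aux]
  constructor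
  · intro h x hx
    exact h {A : IT t | x ∈ A.1} (omega_up_aux t x) hx
  · intro h U hU hA
    exact omega_upper_aux t hU h hA

theorem statement4 {X : Type*} [t : TopologicalSpace X] [T0Space X] :
    ∃ tI : TopologicalSpace (IT t),
      (∀ U : Set (IT t), tI.IsOpen U ↔ OmegaOpen t U) ∧
      @T0Space (IT t) tI ∧
      (∀ A B : IT t, specLE tI A B ↔ A.1 ⊆ B.1) ∧
      BSpace tI ∧
      {A : IT t | dWay tI A A} = {A : IT t | ∃ x : X, A.1 = downSet t {x}} := by
  have hup : ∀ x : X, upSet (omegaTop t) {prinIdeal t x} = {A : IT t | x ∈ A.1} := by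
    intro x
    ext A
    simp only [upSet, mem_singleton_iff, exists_eq_left, mem_setOf_eq]
    rw [omega_spec_aux, prin_sub_iff]
  refine ⟨omegaTop t, fun U => Iff.rfl, ?_, omega_spec_aux t, ?_, ?_⟩
  · letI := omegaTop t
    refine ⟨fun A B h => Subtype.ext (Subset.antisymm ?_ ?_)⟩
    · exact (omega_spec_aux t A B).1 ((spec_iff_aux (omegaTop t) A B).2
        fun U hU hA => (h.mem_open_iff hU).1 hA)
    · exact (omega_spec_aux t B A).1 ((spec_iff_aux (omegaTop t) B A).2
        fun U hU hA => (h.mem_open_iff hU).2 hA)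
  · intro A U hU hA
    obtain ⟨x, hx, h⟩ := ((omega_iff_aux t U).1 hU A).1 hA
    refine ⟨prinIdeal t x, h, ?_⟩
    rw [hup]
    exact ⟨omega_up_aux t x, hx, fun B hB => omega_upper_aux t hU ((prin_sub_iff t B x).2 hB) h⟩
  · ext A
    constructor
    · intro hA
      have hdir : DirSet (omegaTop t) (Set.image (prinIdeal t) A.1) := by
        refine ⟨A.2.1.1.image _, ?_⟩
        rintro _ ⟨x, hx, rfl⟩ _ ⟨y, hy, rfl⟩
        obtain ⟨c, hc, hxc, hyc⟩ := A.2.1.2 x hx y hy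
        refine ⟨_, ⟨c, hc, rfl⟩, ?_, ?_⟩
        · exact (omega_spec_aux t _ _).2 ((prin_sub_iff t _ x).2 ((mem_down_aux t c x).2 hxc))
        · exact (omega_spec_aux t _ _).2 ((prin_sub_iff t _ y).2 ((mem_down_aux t c y).2 hyc))
      have hconv : DConv (omegaTop t) (Set.image (prinIdeal t) A.1) A := by
        intro U hU hAU
        obtain ⟨x, hx, h⟩ := ((omega_iff_aux t U).1 hU A).1 hAU
        exact ⟨_, ⟨x, hx, rfl⟩, h⟩
      obtain ⟨_, ⟨x, hx, rfl⟩, hs⟩ := hA _ hdir hconv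
      exact ⟨x, Subset.antisymm ((omega_spec_aux t _ _).1 hs) ((prin_sub_iff t A x).2 hx)⟩
    · rintro ⟨x, hx⟩
      have e : A = prinIdeal t x := Subtype.ext hx
      subst e
      intro D _ hD
      obtain ⟨B, hB, hxB⟩ := hD _ (omega_up_aux t x) (self_mem_prin t x)
      exact ⟨B, hB, (omega_spec_aux t _ _).2 ((prin_sub_iff t B x).2 hxB)⟩
end
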